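/- arXiv:2603.03032 — 4 statements merged into one kernel-verified Lean document; each statement's English description precedes it below -/
import Mathlib

section
/- Let F : ℝ² → ℝ be bounded, measurable and L-periodic in its first variable, i.e. F(y+L,z) = F(y,z) for all (y,z) ∈ ℝ², and let h ∈ L¹(0,2π). Then ε⁻¹·∫_{R^ε} h(φ)·F(φ/ε, θ/ε)·cos θ dφ dθ → (1/L)·( ∫_{Y*} F(y,z) dy dz )·( ∫₀^{2π} h(φ) dφ ) as ε → 0⁺. -/
open MeasureTheory Filter Real Set
open scoped ENNReal Topology

theorem aux_translation (k : ℝ → ℝ) (hk : Integrable k) :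
    Tendsto (fun t : ℝ => ∫ x, ‖k (t + x) - k x‖) (𝓝 0) (𝓝 0) := by
  have hm : MemLp k 1 volume := memLp_one_iff_integrable.2 hk
  have : Fact ((1 : ℝ≥0∞) ≠ ∞) := ⟨ENNReal.one_ne_top⟩
  have hc : Continuous (fun t : ℝ => ‖(DomAddAct.mk t +ᵥ hm.toLp k) - hm.toLp k‖) := by
    have : Continuous (fun t : ℝ => (DomAddAct.mk t +ᵥ hm.toLp k : Lp ℝ 1 (volume : Measure ℝ))) := by
      have h1 : Continuous (fun t : ℝ => DomAddAct.mk t) := DomAddAct.continuous_mk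
      exact h1.vadd continuous_const
    fun_prop
  have h0 := hc.tendsto 0
  have e : ∀ t : ℝ, ‖(DomAddAct.mk t +ᵥ hm.toLp k) - hm.toLp k‖ = ∫ x, ‖k (t + x) - k x‖ := by
    intro t
    rw [DomAddAct.mk_vadd_toLp, ← MemLp.toLp_sub, L1.norm_eq_integral_norm]
    apply integral_congr_ae
    filter_upwards [MemLp.coeFn_toLp ((hm.comp_measurePreserving (measurePreserving_vadd t volume)).sub hm)] with x hx
    exact congrArg norm hx
  simp_rw [e] at h0
  simpa using h0

theorem aux_averaging (L : ℝ) (hL : 0 < L) (m : ℝ → ℝ) (hm : Measurable m) (M : ℝ)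
    (hM : ∀ y, |m y| ≤ M) (hp : ∀ y, m (y + L) = m y) (k : ℝ → ℝ) (hk : Integrable k) :
    Tendsto (fun ε : ℝ => ∫ x, k x * m (x / ε)) (𝓝[>] 0)
      (𝓝 ((1 / L) * (∫ y in (0:ℝ)..L, m y) * ∫ x, k x)) := by
  have hM0 : 0 ≤ M := (abs_nonneg _).trans (hM 0)
  have hint : ∀ (k : ℝ → ℝ), Integrable k → ∀ ε s : ℝ, Integrable (fun x => k x * m (x / ε + s)) := by
    intro k hk ε s
    exact hk.mul_bdd (c := M) (Measurable.aestronglyMeasurable (by fun_prop)) (ae_of_all _ fun x => hM _)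
  have hint0 : ∀ ε : ℝ, Integrable (fun x => k x * m (x / ε)) := by
    intro ε; simpa using hint k hk ε 0
  set D : ℝ → ℝ → ℝ := fun ε s => (∫ x, k x * m (x / ε)) - ∫ x, k x * m (x / ε + s) with hD
  have hprod : ∀ ε : ℝ, Integrable (fun p : ℝ × ℝ => k p.2 * m (p.2 / ε + p.1))
      ((volume.restrict (Ioc 0 L)).prod volume) := by
    intro ε
    have h1 : Integrable (fun p : ℝ × ℝ => (1:ℝ) * k p.2)
      ((volume.restrict (Ioc 0 L)).prod volume) :=
      Integrable.mul_prod (f := fun _ => (1:ℝ)) (integrable_const _) hk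
    simp only [one_mul] at h1
    exact h1.mul_bdd (c := M) (Measurable.aestronglyMeasurable (by fun_prop)) (ae_of_all _ fun x => hM _)
  -- pointwise limit
  have hDlim : ∀ s : ℝ, Tendsto (fun ε => D ε s) (𝓝[>] 0) (𝓝 0) := by
    intro s
    have ht : Tendsto (fun ε : ℝ => ε * s) (𝓝[>] 0) (𝓝 0) := by
      have : Continuous (fun ε : ℝ => ε * s) := by fun_prop
      simpa using (this.tendsto 0).mono_left nhdsWithin_le_nhds
    have h2 := ((aux_translation k hk).comp ht).const_mul M
    rw [mul_zero] at h2
    refine squeeze_zero_norm' ?_ h2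
    filter_upwards [self_mem_nhdsWithin] with ε hε
    have hε0 : ε ≠ 0 := ne_of_gt hε
    have h3 : (∫ x, k x * m (x / ε)) = ∫ x, k (ε * s + x) * m (x / ε + s) := by
      rw [← integral_add_left_eq_self _ (ε * s)]
      congr 1; ext x; congr 2; field_simp; ring
    have hk' : Integrable (fun x => k (ε * s + x)) := hk.comp_add_left (ε * s)
    simp only [hD, Function.comp]
    rw [h3, ← integral_sub (hint _ hk' ε s) (hint k hk ε s), ← integral_const_mul]
    refine norm_integral_le_of_norm_le ((hk'.sub hk).norm.const_mul M) (ae_of_all _ fun x => ?_)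
    rw [← sub_mul, norm_mul, mul_comm]
    exact mul_le_mul_of_nonneg_right (hM _) (norm_nonneg _)
  have hDb : ∀ ε s, ‖D ε s‖ ≤ 2 * (M * ∫ x, ‖k x‖) := by
    intro ε s
    have hb : ∀ s, ‖∫ x, k x * m (x / ε + s)‖ ≤ M * ∫ x, ‖k x‖ := by
      intro s
      rw [← integral_const_mul]
      refine norm_integral_le_of_norm_le (hk.norm.const_mul M) (ae_of_all _ fun x => ?_)
      rw [norm_mul, mul_comm]
      exact mul_le_mul_of_nonneg_right (hM _) (norm_nonneg _)
    have h1 := hb 0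
    simp only [add_zero] at h1
    have := norm_sub_le (∫ x, k x * m (x / ε)) (∫ x, k x * m (x / ε + s))
    have h2 := hb s
    simp only [hD]; linarith
  have hDint : Tendsto (fun ε => ∫ s in Ioc 0 L, D ε s) (𝓝[>] 0) (𝓝 (∫ s in Ioc 0 L, (0:ℝ))) := by
    refine tendsto_integral_filter_of_dominated_convergence (fun _ => 2 * (M * ∫ x, ‖k x‖)) ?_ ?_ ?_ ?_
    · refine Eventually.of_forall fun ε => ?_
      exact aestronglyMeasurable_const.sub (hprod ε).integral_prod_left.aestronglyMeasurable
    · exact Eventually.of_forall fun ε => ae_of_all _ fun s => hDb ε s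
    · exact integrable_const _
    · exact ae_of_all _ fun s => hDlim s
  have hval : ∀ ε, ∫ s in Ioc 0 L, D ε s = L * (∫ x, k x * m (x / ε)) - (∫ y in (0:ℝ)..L, m y) * ∫ x, k x := by
    intro ε
    simp only [hD]
    rw [integral_sub (integrable_const _) (hprod ε).integral_prod_left]
    congr 1
    · simp [hL.le]
    · rw [integral_integral_swap (hprod ε), ← integral_const_mul]
      congr 1; ext x
      dsimp only
      rw [integral_const_mul, mul_comm]
      congr 1
      rw [← intervalIntegral.integral_of_le hL.le, intervalIntegral.integral_comp_add_left]
      have := Function.Periodic.intervalIntegral_add_eq (f := m) (T := L) hp (x / ε) 0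
      simpa using this
  simp_rw [hval] at hDint
  rw [integral_zero] at hDint
  have h5 := (hDint.add_const ((∫ y in (0:ℝ)..L, m y) * ∫ x, k x)).const_mul (1 / L)
  refine (h5.congr fun ε => ?_).trans ?_
  · field_simp; ring
  · rw [zero_add, mul_assoc]

theorem aux_main
    (L : ℝ) (hLpos : 0 < L)
    (g : ℝ → ℝ) (hgc : Continuous g) (hper : ∀ y, g (y + L) = g y)
    (g₁ : ℝ) (hg₁pos : 0 < g₁) (hgle : ∀ y, g y ≤ g₁)
    (F : ℝ × ℝ → ℝ) (hFm : Measurable F) (C : ℝ) (hFb : ∀ q, |F q| ≤ C)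
    (hFper : ∀ y z : ℝ, F (y + L, z) = F (y, z))
    (h : ℝ → ℝ) (hh : IntegrableOn h (Ioo 0 (2 * π))) :
    Tendsto
      (fun ε : ℝ => ε⁻¹ *
        ∫ p in {p : ℝ × ℝ | 0 < p.1 ∧ p.1 < 2 * π ∧ 0 < p.2 ∧ p.2 < ε * g (p.1 / ε)},
          h p.1 * F (p.1 / ε, p.2 / ε) * Real.cos p.2)
      (𝓝[>] 0)
      (𝓝 ((1 / L) *
        (∫ q in {q : ℝ × ℝ | 0 < q.1 ∧ q.1 < L ∧ 0 < q.2 ∧ q.2 < g q.1}, F q) *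
        ∫ φ in Ioo 0 (2 * π), h φ)) := by
  have hgm : Measurable g := hgc.measurable
  have hC : 0 ≤ C := (abs_nonneg _).trans (hFb 0)
  set S : Set (ℝ × ℝ) := {q | 0 < q.2 ∧ q.2 < g q.1} with hS
  have hSm : MeasurableSet S :=
    (measurableSet_lt measurable_const measurable_snd).inter
      (measurableSet_lt measurable_snd (hgm.comp measurable_fst))
  set G : ℝ × ℝ → ℝ := S.indicator F with hG
  have hGm : Measurable G := hFm.indicator hSm
  have hGb : ∀ y z, ‖G (y, z)‖ ≤ (Ioo 0 g₁).indicator (fun _ => C) z := by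
    intro y z
    by_cases hz : (y, z) ∈ S
    · have hz2 : z ∈ Ioo 0 g₁ := ⟨hz.1, hz.2.trans_le (hgle y)⟩
      rw [hG, indicator_of_mem hz, indicator_of_mem hz2]
      exact hFb _
    · rw [hG, indicator_of_notMem hz, norm_zero]
      exact indicator_nonneg (fun _ _ => hC) _
  have hGbC : ∀ q, ‖G q‖ ≤ C := by
    intro q
    refine (hGb q.1 q.2).trans ?_
    exact indicator_le_self' (fun _ _ => hC) _
  have hbi : Integrable ((Ioo 0 g₁).indicator (fun _ : ℝ => C)) := by
    rw [integrable_indicator_iff measurableSet_Ioo]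
    exact integrableOn_const (by simp)
  have hbv : ∫ z, (Ioo 0 g₁).indicator (fun _ : ℝ => C) z = g₁ * C := by
    rw [integral_indicator measurableSet_Ioo]; simp [hg₁pos.le]
  have hGi : ∀ y, Integrable (fun z => G (y, z)) := fun y =>
    hbi.mono' (Measurable.aestronglyMeasurable (by fun_prop)) (ae_of_all _ (hGb y))
  have hGci : ∀ ε y, Integrable (fun z => G (y, z) * cos (ε * z)) := fun ε y =>
    (hGi y).mul_bdd (c := 1) (by fun_prop) (ae_of_all _ fun z => abs_cos_le_one _)
  set m : ℝ → ℝ := fun y => ∫ z, G (y, z) with hm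
  set mm : ℝ → ℝ → ℝ := fun ε y => ∫ z, G (y, z) * cos (ε * z) with hmm
  have hmmeas : Measurable m :=
    (hGm.stronglyMeasurable.integral_prod_right' (ν := volume)).measurable
  have hmmmeas : ∀ ε, Measurable (mm ε) := fun ε =>
    (StronglyMeasurable.integral_prod_right' (ν := volume)
      (f := fun p : ℝ × ℝ => G p * cos (ε * p.2)) (Measurable.stronglyMeasurable (by fun_prop))).measurable
  have hmb : ∀ y, |m y| ≤ g₁ * C := by
    intro y
    rw [← hbv]
    exact norm_integral_le_of_norm_le hbi (ae_of_all _ (hGb y))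
  have hmper : ∀ y, m (y + L) = m y := by
    intro y
    simp only [hm]
    congr 1; ext z
    simp only [hG, hS, indicator, mem_setOf_eq, hper, hFper]
  have hmmb : ∀ ε y, ‖mm ε y - m y‖ ≤ (ε * g₁) ^ 2 / 2 * (g₁ * C) := by
    intro ε y
    simp only [hmm, hm]
    rw [← integral_sub (hGci ε y) (hGi y), ← hbv, ← integral_const_mul]
    refine norm_integral_le_of_norm_le (hbi.const_mul _) (ae_of_all _ fun z => ?_)
    have e : G (y, z) * cos (ε * z) - G (y, z) = (cos (ε * z) - 1) * G (y, z) := by ring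
    rw [e, norm_mul]
    by_cases hz : z ∈ Ioo 0 g₁
    · refine mul_le_mul ?_ (hGb y z) (norm_nonneg _) (by positivity)
      have h1 := cos_le_one (ε * z)
      have h2 := one_sub_sq_div_two_le_cos (x := ε * z)
      rw [Real.norm_eq_abs, abs_of_nonpos (by linarith)]
      have h3 : (ε * z) ^ 2 ≤ (ε * g₁) ^ 2 := by
        rw [mul_pow, mul_pow]
        have := hz.1; have := hz.2
        gcongr
      linarith
    · have h1 := hGb y z
      rw [indicator_of_notMem hz] at h1 ⊢
      have : ‖G (y, z)‖ = 0 := le_antisymm h1 (norm_nonneg _)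
      rw [this]; simp
  set k : ℝ → ℝ := (Ioo 0 (2 * π)).indicator h with hkdef
  have hk : Integrable k := by rwa [hkdef, integrable_indicator_iff measurableSet_Ioo]
  have hkv : ∫ x, k x = ∫ φ in Ioo 0 (2 * π), h φ := integral_indicator measurableSet_Ioo
  have hav := aux_averaging L hLpos m hmmeas _ hmb hmper k hk
  have hY : ∫ q in {q : ℝ × ℝ | 0 < q.1 ∧ q.1 < L ∧ 0 < q.2 ∧ q.2 < g q.1}, F q
      = ∫ y in (0:ℝ)..L, m y := by
    have hm1 : MeasurableSet {q : ℝ × ℝ | 0 < q.1 ∧ q.1 < L ∧ 0 < q.2 ∧ q.2 < g q.1} := by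
      have : {q : ℝ × ℝ | 0 < q.1 ∧ q.1 < L ∧ 0 < q.2 ∧ q.2 < g q.1} = (Prod.fst ⁻¹' Ioo 0 L) ∩ S := by
        ext q; simp [hS, and_assoc]
      rw [this]; exact (measurable_fst measurableSet_Ioo).inter hSm
    have e1 : ({q : ℝ × ℝ | 0 < q.1 ∧ q.1 < L ∧ 0 < q.2 ∧ q.2 < g q.1}).indicator F
        = fun q => (Ioo 0 L).indicator (fun _ => (1:ℝ)) q.1 * G q := by
      ext q
      by_cases h1 : q.1 ∈ Ioo 0 L
      · by_cases h2 : q ∈ S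
        · rw [indicator_of_mem h1, hG, indicator_of_mem h2, indicator_of_mem, one_mul]
          exact ⟨h1.1, h1.2, h2.1, h2.2⟩
        · rw [hG, indicator_of_notMem h2, indicator_of_notMem, mul_zero]
          exact fun h3 => h2 ⟨h3.2.2.1, h3.2.2.2⟩
      · rw [indicator_of_notMem h1, indicator_of_notMem, zero_mul]
        exact fun h3 => h1 ⟨h3.1, h3.2.1⟩
    have hI : Integrable (fun q : ℝ × ℝ => (Ioo 0 L).indicator (fun _ => (1:ℝ)) q.1 * G q)
        (volume.prod volume) := by
      have hi1 : Integrable ((Ioo 0 L).indicator (fun _ : ℝ => (1:ℝ))) := by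
        rw [integrable_indicator_iff measurableSet_Ioo]
        exact integrableOn_const (by simp)
      refine (hi1.mul_prod hbi).mono' ?_ (ae_of_all _ fun q => ?_)
      · have : Measurable ((Ioo 0 L).indicator (fun _ : ℝ => (1:ℝ))) :=
          measurable_const.indicator measurableSet_Ioo
        exact Measurable.aestronglyMeasurable (by fun_prop)
      · rw [norm_mul, Real.norm_of_nonneg (indicator_nonneg (fun _ _ => zero_le_one) _)]
        exact mul_le_mul_of_nonneg_left (hGb q.1 q.2) (indicator_nonneg (fun _ _ => zero_le_one) _)
    rw [← integral_indicator hm1, e1, Measure.volume_eq_prod, integral_prod _ hI,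
      intervalIntegral.integral_of_le hLpos.le, integral_Ioc_eq_integral_Ioo,
      ← integral_indicator measurableSet_Ioo]
    congr 1; ext y
    dsimp only
    rw [integral_const_mul]
    by_cases h1 : y ∈ Ioo 0 L
    · rw [indicator_of_mem h1, indicator_of_mem h1, one_mul]
    · rw [indicator_of_notMem h1, indicator_of_notMem h1, zero_mul]
  have hX : ∀ ε : ℝ, 0 < ε → ε⁻¹ *
        ∫ p in {p : ℝ × ℝ | 0 < p.1 ∧ p.1 < 2 * π ∧ 0 < p.2 ∧ p.2 < ε * g (p.1 / ε)},
          h p.1 * F (p.1 / ε, p.2 / ε) * Real.cos p.2 = ∫ x, k x * mm ε (x / ε) := by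
    intro ε hε
    have hm1 : MeasurableSet {p : ℝ × ℝ | 0 < p.1 ∧ p.1 < 2 * π ∧ 0 < p.2 ∧ p.2 < ε * g (p.1 / ε)} := by
      refine (measurableSet_lt measurable_const measurable_fst).inter
        ((measurableSet_lt measurable_fst measurable_const).inter
        ((measurableSet_lt measurable_const measurable_snd).inter
        (measurableSet_lt measurable_snd (by fun_prop))))
    have e1 : ({p : ℝ × ℝ | 0 < p.1 ∧ p.1 < 2 * π ∧ 0 < p.2 ∧ p.2 < ε * g (p.1 / ε)}).indicator
        (fun p => h p.1 * F (p.1 / ε, p.2 / ε) * Real.cos p.2)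
        = fun p => k p.1 * (G (p.1 / ε, p.2 / ε) * cos (ε * (p.2 / ε))) := by
      ext p
      have hc : ε * (p.2 / ε) = p.2 := by field_simp
      have hSi : (p.1 / ε, p.2 / ε) ∈ S ↔ 0 < p.2 ∧ p.2 < ε * g (p.1 / ε) := by
        simp only [hS, mem_ofPred_eq, div_pos_iff_of_pos_right hε, div_lt_iff₀' hε]
      rw [hc]
      by_cases h1 : p.1 ∈ Ioo 0 (2 * π)
      · by_cases h2 : (p.1 / ε, p.2 / ε) ∈ S
        · rw [hkdef, indicator_of_mem h1, hG, indicator_of_mem h2, indicator_of_mem, mul_assoc]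
          exact ⟨h1.1, h1.2, hSi.1 h2⟩
        · rw [hG, indicator_of_notMem h2, indicator_of_notMem, zero_mul, mul_zero]
          exact fun h3 => h2 (hSi.2 h3.2.2)
      · rw [hkdef, indicator_of_notMem h1, indicator_of_notMem, zero_mul]
        exact fun h3 => h1 ⟨h3.1, h3.2.1⟩
    have hI : Integrable (fun p : ℝ × ℝ => k p.1 * (G (p.1 / ε, p.2 / ε) * cos (ε * (p.2 / ε))))
        (volume.prod volume) := by
      have hb2 : Integrable (fun z => (Ioo 0 g₁).indicator (fun _ : ℝ => C) (z / ε)) :=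
        hbi.comp_div hε.ne'
      refine (hk.norm.mul_prod hb2).mono' ?_ (ae_of_all _ fun q => ?_)
      · have h1 : AEStronglyMeasurable (fun p : ℝ × ℝ => k p.1) (volume.prod volume) :=
          hk.aestronglyMeasurable.comp_fst
        exact h1.mul (Measurable.aestronglyMeasurable (by fun_prop))
      · rw [norm_mul, norm_mul]
        refine mul_le_mul_of_nonneg_left ?_ (norm_nonneg _)
        calc _ ≤ ‖G (q.1 / ε, q.2 / ε)‖ * 1 :=
              mul_le_mul_of_nonneg_left (abs_cos_le_one _) (norm_nonneg _)
          _ ≤ _ := by rw [mul_one]; exact hGb _ _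
    rw [← integral_indicator hm1, e1, Measure.volume_eq_prod, integral_prod _ hI, ← integral_const_mul]
    congr 1; ext x
    dsimp only
    rw [integral_const_mul, Measure.integral_comp_div (fun z => G (x / ε, z) * cos (ε * z)) ε,
      abs_of_pos hε, smul_eq_mul]
    simp only [hmm]
    field_simp
  rw [hY, ← hkv]
  have hdiff : Tendsto (fun ε : ℝ => (∫ x, k x * mm ε (x / ε)) - ∫ x, k x * m (x / ε))
      (𝓝[>] 0) (𝓝 0) := by
    have h2 : Tendsto (fun ε : ℝ => (ε * g₁) ^ 2 / 2 * (g₁ * C) * ∫ x, ‖k x‖) (𝓝[>] 0) (𝓝 0) := by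
      have : Continuous (fun ε : ℝ => (ε * g₁) ^ 2 / 2 * (g₁ * C) * ∫ x, ‖k x‖) := by fun_prop
      simpa using (this.tendsto 0).mono_left nhdsWithin_le_nhds
    refine squeeze_zero_norm (fun ε => ?_) h2
    have hi1 : Integrable (fun x => k x * m (x / ε)) :=
      hk.mul_bdd (c := g₁ * C) (Measurable.aestronglyMeasurable (by fun_prop)) (ae_of_all _ fun x => hmb _)
    have hi2 : Integrable (fun x => k x * (mm ε (x / ε) - m (x / ε))) := by
      have := hmmmeas ε
      exact hk.mul_bdd (c := (ε * g₁) ^ 2 / 2 * (g₁ * C)) (Measurable.aestronglyMeasurable (by fun_prop))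
        (ae_of_all _ fun x => hmmb _ _)
    have hi3 : Integrable (fun x => k x * mm ε (x / ε)) := by
      refine (hi1.add hi2).congr (ae_of_all _ fun x => ?_)
      simp only [Pi.add_apply]; ring
    rw [← integral_sub hi3 hi1, ← integral_const_mul]
    refine norm_integral_le_of_norm_le (hk.norm.const_mul _) (ae_of_all _ fun x => ?_)
    rw [← mul_sub, norm_mul, mul_comm]
    exact mul_le_mul_of_nonneg_right (hmmb _ _) (norm_nonneg _)
  have hfin := hdiff.add hav
  rw [zero_add] at hfin
  refine hfin.congr' ?_
  filter_upwards [self_mem_nhdsWithin] with ε hε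
  rw [hX ε hε]; ring

/-- Averaging limit on the thin oscillating domain: for `F` bounded, measurable and
`L`-periodic in its first variable, and `h ∈ L¹(0,2π)`,
`ε⁻¹ ∫_{R^ε} h(φ) F(φ/ε,θ/ε) cos θ dφ dθ → (1/L)(∫_{Y*} F)(∫₀^{2π} h)` as `ε → 0⁺`. -/
theorem thin_domain_averaging_limit
    (a : ℕ) (ha : 0 < a) (L : ℝ) (hL : L = 2 * π / a)
    (g : ℝ → ℝ) (hgc : Continuous g) (hper : ∀ y, g (y + L) = g y)
    (g₁ : ℝ) (hg₁pos : 0 < g₁) (hg₁lt : g₁ < π / 2)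
    (hgpos : ∀ y, 0 < g y) (hgle : ∀ y, g y ≤ g₁)
    (F : ℝ × ℝ → ℝ) (hFm : Measurable F) (C : ℝ) (hFb : ∀ q, |F q| ≤ C)
    (hFper : ∀ y z : ℝ, F (y + L, z) = F (y, z))
    (h : ℝ → ℝ) (hh : IntegrableOn h (Ioo 0 (2 * π))) :
    Tendsto
      (fun ε : ℝ => ε⁻¹ *
        ∫ p in {p : ℝ × ℝ | 0 < p.1 ∧ p.1 < 2 * π ∧ 0 < p.2 ∧ p.2 < ε * g (p.1 / ε)},
          h p.1 * F (p.1 / ε, p.2 / ε) * Real.cos p.2)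
      (𝓝[>] 0)
      (𝓝 ((1 / L) *
        (∫ q in {q : ℝ × ℝ | 0 < q.1 ∧ q.1 < L ∧ 0 < q.2 ∧ q.2 < g q.1}, F q) *
        ∫ φ in Ioo 0 (2 * π), h φ)) := by
  have hLpos : 0 < L := by
    rw [hL]; have : (0:ℝ) < a := by exact_mod_cast ha
    positivity
  exact aux_main L hLpos g hgc hper g₁ hg₁pos hgle F hFm C hFb hFper h hh
end

section
/- Let X : ℝ² → ℝ be continuously differentiable with X(y+L,z) = X(y,z) for all (y,z) ∈ ℝ², and suppose that for every continuously differentiable φ : ℝ² → ℝ satisfying φ(y+L,z) = φ(y,z) for all (y,z) one has ∫_{Y*} ∇X·∇φ dy dz = ∫_{Y*} ∂φ/∂y dy dz. Then ∫_{Y*} (1 − ∂X/∂y) dy dz = ∫_{Y*} ‖∇X − e₁‖² dy dz > 0; in particular, the homogenized coefficient q₀ = (1/|Y*|)·∫_{Y*} (1 − ∂X/∂y) dy dz is strictly positive, where |Y*| is the Lebesgue measure of Y*. -/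
open MeasureTheory Filter Real Set
open scoped ENNReal Topology

/-- Positivity of the homogenized coefficient `q₀`: if `X` is a (smooth, periodic) solution
of the weak cell problem on `Y*`, then
`∫_{Y*}(1 - ∂X/∂y) = ∫_{Y*} ‖∇X − e₁‖² > 0`, hence `q₀ > 0`. -/
theorem homogenized_coefficient_positive
    (a : ℕ) (ha : 0 < a) (L : ℝ) (hL : L = 2 * π / a)
    (g : ℝ → ℝ) (hgc : Continuous g) (hper : ∀ y, g (y + L) = g y)
    (g₁ : ℝ) (hg₁pos : 0 < g₁) (hg₁lt : g₁ < π / 2)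
    (hgpos : ∀ y, 0 < g y) (hgle : ∀ y, g y ≤ g₁)
    (Ystar : Set (ℝ × ℝ))
    (hY : Ystar = {p : ℝ × ℝ | 0 < p.1 ∧ p.1 < L ∧ 0 < p.2 ∧ p.2 < g p.1})
    (X : ℝ × ℝ → ℝ) (hX : ContDiff ℝ 1 X)
    (hXper : ∀ y z : ℝ, X (y + L, z) = X (y, z))
    (hweak : ∀ φ : ℝ × ℝ → ℝ, ContDiff ℝ 1 φ → (∀ y z : ℝ, φ (y + L, z) = φ (y, z)) →
      (∫ p in Ystar,
          (fderiv ℝ X p (1, 0) * fderiv ℝ φ p (1, 0) +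
            fderiv ℝ X p (0, 1) * fderiv ℝ φ p (0, 1)))
        = ∫ p in Ystar, fderiv ℝ φ p (1, 0)) :
    (∫ p in Ystar, (1 - fderiv ℝ X p (1, 0)))
        = (∫ p in Ystar, ((fderiv ℝ X p (1, 0) - 1) ^ 2 + (fderiv ℝ X p (0, 1)) ^ 2)) ∧
    (0 < ∫ p in Ystar, (1 - fderiv ℝ X p (1, 0))) ∧
    0 < (volume Ystar).toReal⁻¹ * ∫ p in Ystar, (1 - fderiv ℝ X p (1, 0)) := by
  have hLpos : 0 < L := by rw [hL]; positivity
  have hc1 : Continuous fun p => fderiv ℝ X p (1, 0) :=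
    (hX.continuous_fderiv one_ne_zero).clm_apply continuous_const
  have hc2 : Continuous fun p => fderiv ℝ X p (0, 1) :=
    (hX.continuous_fderiv one_ne_zero).clm_apply continuous_const
  have hopen : IsOpen Ystar := by
    rw [hY]
    exact (isOpen_lt continuous_const continuous_fst).inter
      ((isOpen_lt continuous_fst continuous_const).inter
      ((isOpen_lt continuous_const continuous_snd).inter
      (isOpen_lt continuous_snd (hgc.comp continuous_fst))))
  have hsub : Ystar ⊆ Icc ((0 : ℝ), (0 : ℝ)) (L, g₁) := by
    rw [hY]
    rintro ⟨y, z⟩ ⟨h1, h2, h3, h4⟩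
    exact ⟨⟨h1.le, h3.le⟩, ⟨h2.le, h4.le.trans (hgle y)⟩⟩
  have hint : ∀ f : ℝ × ℝ → ℝ, Continuous f → IntegrableOn f Ystar := fun f hf =>
    (hf.continuousOn.integrableOn_compact isCompact_Icc).mono_set hsub
  have hw := hweak X hX hXper
  have heq : (∫ p in Ystar, (1 - fderiv ℝ X p (1, 0)))
      = (∫ p in Ystar, ((fderiv ℝ X p (1, 0) - 1) ^ 2 + (fderiv ℝ X p (0, 1)) ^ 2)) := by
    have h0 : (∫ p in Ystar, ((fderiv ℝ X p (1, 0) - 1) ^ 2 + (fderiv ℝ X p (0, 1)) ^ 2))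
        = ∫ p in Ystar, ((1 - fderiv ℝ X p (1, 0)) +
          ((fderiv ℝ X p (1, 0) * fderiv ℝ X p (1, 0) +
            fderiv ℝ X p (0, 1) * fderiv ℝ X p (0, 1)) - fderiv ℝ X p (1, 0))) := by
      congr 1; ext p; ring
    rw [h0, integral_add (hint _ (by fun_prop)) (hint _ (by fun_prop)),
      integral_sub (hint _ (by fun_prop)) (hint _ (by fun_prop)),
      integral_sub (hint _ (by fun_prop)) (hint _ (by fun_prop)), hw]
    ring
  -- a horizontal segment inside the cell
  obtain ⟨y₀, -, hy₀⟩ := isCompact_Icc.exists_isMinOn (nonempty_Icc.2 hLpos.le)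
    (hgc.continuousOn (s := Icc 0 L))
  set z : ℝ := g y₀ / 2 with hz
  have hz0 : 0 < z := half_pos (hgpos y₀)
  have hder : ∀ y : ℝ, HasDerivAt (fun t : ℝ => X (t, z)) (fderiv ℝ X (y, z) (1, 0)) y := by
    intro y
    have h1 : HasFDerivAt X (fderiv ℝ X (y, z)) (y, z) :=
      (hX.differentiable one_ne_zero (y, z)).hasFDerivAt
    exact h1.comp_hasDerivAt y ((hasDerivAt_id y).prodMk (hasDerivAt_const y z))
  obtain ⟨c, hc, hc0⟩ := exists_hasDerivAt_eq_zero (f := fun t : ℝ => X (t, z)) hLpos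
    (fun y _ => (hder y).continuousAt.continuousWithinAt)
    (by have := hXper 0 z; rw [zero_add] at this; exact this.symm)
    (fun y _ => hder y)
  have hcY : (c, z) ∈ Ystar := by
    rw [hY]
    have : g y₀ ≤ g c := hy₀ ⟨hc.1.le, hc.2.le⟩
    exact ⟨hc.1, hc.2, hz0, (half_lt_self (hgpos y₀)).trans_le this⟩
  have hFc : Continuous fun p => (fderiv ℝ X p (1, 0) - 1) ^ 2 + (fderiv ℝ X p (0, 1)) ^ 2 := by
    fun_prop
  have hpos : 0 < ∫ p in Ystar, (1 - fderiv ℝ X p (1, 0)) := by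
    rw [heq, setIntegral_pos_iff_support_of_nonneg_ae
      (Eventually.of_forall fun p => by simp only [Pi.zero_apply]; positivity) (hint _ hFc)]
    refine (hFc.isOpen_support.inter hopen).measure_pos _ ⟨(c, z), ?_, hcY⟩
    simp only [Function.mem_support, hc0]
    positivity
  refine ⟨heq, hpos, mul_pos (inv_pos.2 (ENNReal.toReal_pos ?_ ?_)) hpos⟩
  · exact (hopen.measure_pos _ ⟨_, hcY⟩).ne'
  · exact ((measure_mono hsub).trans_lt isCompact_Icc.measure_lt_top).ne
end

section
/- Let 1 ≤ p < ∞ and ε ∈ (0,1]. For every measurable φ : ℝ² → ℝ one has ∫_𝒪 |Pφ(x₁,x₂)|^p dx₁ dx₂ ≤ (2/cos G₁)·∫_{𝒪_G} |φ(x₁,x₂)|^p·cos(ε·x₂) dx₁ dx₂; in particular, the reflected extension operator P is bounded from the weighted Lebesgue space L^p(𝒪_G, cos(εx₂) dx) to L^p(𝒪), with a bound independent of ε ∈ (0,1] and of p. -/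
open MeasureTheory Filter Real Set
open scoped ENNReal Topology


lemma graph_null_aux (G : ℝ → ℝ) (hGm : Measurable G) :
    (volume : Measure (ℝ × ℝ)) {x : ℝ × ℝ | x.2 = G x.1} = 0 := by
  have hm : MeasurableSet {x : ℝ × ℝ | x.2 = G x.1} :=
    measurableSet_eq_fun measurable_snd (hGm.comp measurable_fst)
  rw [Measure.volume_eq_prod, Measure.measure_prod_null hm]
  refine Filter.Eventually.of_forall fun a => ?_
  have : Prod.mk a ⁻¹' {x : ℝ × ℝ | x.2 = G x.1} = {G a} := by
    ext y; simp
  change volume (Prod.mk a ⁻¹' {x : ℝ × ℝ | x.2 = G x.1}) = 0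
  rw [this]; simp

lemma reflect_mp_aux (G : ℝ → ℝ) (hGm : Measurable G) :
    MeasurePreserving (fun x : ℝ × ℝ => (x.1, 2 * G x.1 - x.2)) volume volume := by
  rw [Measure.volume_eq_prod]
  refine MeasurePreserving.skew_product (f := id) (g := fun a b => 2 * G a - b)
    (MeasurePreserving.id _) (by fun_prop) ?_
  exact Filter.Eventually.of_forall fun a => (Measure.measurePreserving_sub_left volume (2 * G a)).map_eq

/-- The reflected extension operator is bounded from the weighted space
`L^p(𝒪_G, cos(εx₂)dx)` to `L^p(𝒪)`, with constant `2 / cos G₁` independent of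
`ε ∈ (0,1]` and of `p`. -/
theorem reflected_extension_operator_bounded
    (α β : ℝ) (hαβ : α < β)
    (G : ℝ → ℝ) (hGm : Measurable G) (G₀ G₁ : ℝ) (hG₀ : 0 < G₀)
    (hGlb : ∀ x, G₀ ≤ G x) (hGub : ∀ x, G x ≤ G₁)
    (hG₁ : G₁ ≤ 2 * G₀) (hG₁' : G₁ < π / 2)
    (p : ℝ) (hp : 1 ≤ p) (ε : ℝ) (hε : ε ∈ Ioc (0 : ℝ) 1)
    (φ : ℝ × ℝ → ℝ) (hφ : Measurable φ) :
    (∫ x in {x : ℝ × ℝ | x.1 ∈ Ioo α β ∧ 0 < x.2 ∧ x.2 < G₁},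
        |if x.2 < G x.1 then φ x else φ (x.1, 2 * G x.1 - x.2)| ^ p)
      ≤ (2 / Real.cos G₁) *
        ∫ x in {x : ℝ × ℝ | x.1 ∈ Ioo α β ∧ 0 < x.2 ∧ x.2 < G x.1},
          |φ x| ^ p * Real.cos (ε * x.2) := by
  obtain ⟨hε0, hε1⟩ := hε
  have hG₁0 : 0 < G₁ := lt_of_lt_of_le hG₀ ((hGlb 0).trans (hGub 0))
  have hc : 0 < Real.cos G₁ := Real.cos_pos_of_mem_Ioo ⟨by linarith, hG₁'⟩
  set O := {x : ℝ × ℝ | x.1 ∈ Ioo α β ∧ 0 < x.2 ∧ x.2 < G₁} with hO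
  set OG := {x : ℝ × ℝ | x.1 ∈ Ioo α β ∧ 0 < x.2 ∧ x.2 < G x.1} with hOG
  have hG1 : Measurable fun x : ℝ × ℝ => G x.1 := hGm.comp measurable_fst
  have hI : MeasurableSet {x : ℝ × ℝ | x.1 ∈ Ioo α β} := measurable_fst measurableSet_Ioo
  have h0 : MeasurableSet {x : ℝ × ℝ | 0 < x.2} := measurableSet_lt measurable_const measurable_snd
  have hlt : MeasurableSet {x : ℝ × ℝ | x.2 < G x.1} := measurableSet_lt measurable_snd hG1
  have mOG : MeasurableSet OG := hI.inter (h0.inter hlt)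
  have mO : MeasurableSet O := hI.inter (h0.inter (measurableSet_lt measurable_snd measurable_const))
  set T : ℝ × ℝ → ℝ × ℝ := fun x => (x.1, 2 * G x.1 - x.2) with hT
  have mpT : MeasurePreserving T volume volume := reflect_mp_aux G hGm
  set F : ℝ × ℝ → ℝ := fun x => |if x.2 < G x.1 then φ x else φ (T x)| ^ p with hF
  have mf : Measurable fun x => |φ x| ^ p := by fun_prop
  have mF : Measurable F :=
    (Measurable.ite hlt hφ (hφ.comp mpT.measurable)).abs.pow_const p
  set f : ℝ × ℝ → ℝ≥0∞ := fun x => ENNReal.ofReal (|φ x| ^ p) with hf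
  have mf' : Measurable f := mf.ennreal_ofReal
  have mw : Measurable fun x : ℝ × ℝ => |φ x| ^ p * Real.cos (ε * x.2) := by fun_prop
  have hcos : ∀ x ∈ OG, Real.cos G₁ ≤ Real.cos (ε * x.2) := by
    rintro x ⟨-, hx0, hxG⟩
    have h2 := hGub x.1
    apply Real.cos_le_cos_of_nonneg_of_le_pi
    · positivity
    · linarith [Real.pi_pos]
    · nlinarith
  -- the three lower integrals
  have hOGsub : OG ⊆ O := fun x hx => ⟨hx.1, hx.2.1, hx.2.2.trans_le (hGub _)⟩
  have key1 : ∫⁻ x in OG, f x ≤ ∫⁻ x in O, ENNReal.ofReal (F x) := by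
    calc ∫⁻ x in OG, f x = ∫⁻ x in OG, ENNReal.ofReal (F x) := by
          refine setLIntegral_congr_fun mOG fun x hx => ?_
          simp only [hf, hF, if_pos hx.2.2]
      _ ≤ _ := lintegral_mono_set hOGsub
  have key2 : ∫⁻ x in O, ENNReal.ofReal (F x) ≤ 2 * ∫⁻ x in OG, f x := by
    set C := {x : ℝ × ℝ | x.2 = G x.1} with hC
    set R := O \ OG with hR
    have mC : MeasurableSet C := measurableSet_eq_fun measurable_snd hG1
    have hRF : ∫⁻ x in R, ENNReal.ofReal (F x) = ∫⁻ x in R, f (T x) := by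
      refine setLIntegral_congr_fun (mO.diff mOG) fun x hx => ?_
      have : ¬ x.2 < G x.1 := fun h => hx.2 ⟨hx.1.1, hx.1.2.1, h⟩
      simp only [hf, hF, if_neg this]
    have hRT : R ⊆ T ⁻¹' (OG ∪ C) := by
      rintro x ⟨⟨h1, h2, h3⟩, hx⟩
      have : G x.1 ≤ x.2 := not_lt.1 fun h => hx ⟨h1, h2, h⟩
      have h4 := hGlb x.1
      rcases this.eq_or_lt with h | h
      · right
        change 2 * G x.1 - x.2 = G x.1
        linarith
      · left
        refine ⟨h1, ?_, ?_⟩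
        · change 0 < 2 * G x.1 - x.2
          linarith
        · change 2 * G x.1 - x.2 < G x.1
          linarith
    have hRle : ∫⁻ x in R, f (T x) ≤ ∫⁻ x in OG, f x := by
      calc ∫⁻ x in R, f (T x) ≤ ∫⁻ x in T ⁻¹' (OG ∪ C), f (T x) := lintegral_mono_set hRT
        _ = ∫⁻ x in OG ∪ C, f x := mpT.setLIntegral_comp_preimage (mOG.union mC) mf'
        _ ≤ (∫⁻ x in OG, f x) + ∫⁻ x in C, f x := lintegral_union_le _ _ _
        _ = ∫⁻ x in OG, f x := by
          rw [setLIntegral_measure_zero C f (graph_null_aux G hGm), add_zero]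
    calc ∫⁻ x in O, ENNReal.ofReal (F x) 
        ≤ ∫⁻ x in OG ∪ R, ENNReal.ofReal (F x) := lintegral_mono_set (by
          intro x hx
          by_cases h : x ∈ OG
          · exact Or.inl h
          · exact Or.inr ⟨hx, h⟩)
      _ ≤ (∫⁻ x in OG, ENNReal.ofReal (F x)) + ∫⁻ x in R, ENNReal.ofReal (F x) :=
          lintegral_union_le _ _ _
      _ ≤ (∫⁻ x in OG, f x) + ∫⁻ x in OG, f x := by
          refine add_le_add (le_of_eq ?_) (hRF.le.trans hRle)
          refine setLIntegral_congr_fun mOG fun x hx => ?_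
          simp only [hf, hF, if_pos hx.2.2]
      _ = _ := (two_mul _).symm
  have key3 : ENNReal.ofReal (Real.cos G₁) * ∫⁻ x in OG, f x
      ≤ ∫⁻ x in OG, ENNReal.ofReal (|φ x| ^ p * Real.cos (ε * x.2)) := by
    rw [← lintegral_const_mul _ mf']
    refine setLIntegral_mono mw.ennreal_ofReal fun x hx => ?_
    rw [hf, ← ENNReal.ofReal_mul hc.le]
    refine ENNReal.ofReal_le_ofReal ?_
    rw [mul_comm]
    exact mul_le_mul_of_nonneg_left (hcos x hx) (by positivity)
  have key4 : ∫⁻ x in OG, ENNReal.ofReal (|φ x| ^ p * Real.cos (ε * x.2)) ≤ ∫⁻ x in OG, f x := by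
    refine lintegral_mono fun x => ENNReal.ofReal_le_ofReal ?_
    exact mul_le_of_le_one_right (by positivity) (Real.cos_le_one _)
  have e1 : ∫ x in O, F x = (∫⁻ x in O, ENNReal.ofReal (F x)).toReal :=
    integral_eq_lintegral_of_nonneg_ae
      (Filter.Eventually.of_forall fun x => by simp only [hF, Pi.zero_apply]; positivity)
      mF.aestronglyMeasurable
  have e2 : ∫ x in OG, |φ x| ^ p * Real.cos (ε * x.2)
      = (∫⁻ x in OG, ENNReal.ofReal (|φ x| ^ p * Real.cos (ε * x.2))).toReal := by
    refine integral_eq_lintegral_of_nonneg_ae ?_ mw.aestronglyMeasurable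
    refine (ae_restrict_iff' mOG).2 (Filter.Eventually.of_forall fun x hx => ?_)
    exact mul_nonneg (by positivity) (hc.le.trans (hcos x hx))
  change ∫ x in O, F x ≤ _
  rw [e1, e2]
  generalize (∫⁻ x in O, ENNReal.ofReal (F x)) = A at *
  generalize (∫⁻ x in OG, ENNReal.ofReal (|φ x| ^ p * Real.cos (ε * x.2))) = B at *
  generalize (∫⁻ x in OG, f x) = D at *
  by_cases hD : D = ∞
  · have : A = ∞ := top_le_iff.1 (hD ▸ key1)
    rw [this, ENNReal.toReal_top]
    positivity
  · have hB : B ≠ ∞ := ne_top_of_le_ne_top hD key4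
    have i2 := ENNReal.toReal_mono (ENNReal.mul_ne_top (by simp) hD) key2
    have i3 := ENNReal.toReal_mono hB key3
    rw [ENNReal.toReal_mul] at i2 i3
    rw [ENNReal.toReal_ofReal hc.le] at i3
    simp only [ENNReal.toReal_ofNat] at i2
    rw [div_mul_eq_mul_div, le_div_iff₀ hc]
    nlinarith
end

section
/- Let F : ℝ² → ℝ be continuously differentiable and L-periodic in its first variable, and let v : ℝ → ℝ be three times continuously differentiable with v'' and v''' bounded on (0,2π). Then there exists a constant K > 0, independent of ε, such that for every ε ∈ (0,1] for which 2π/(εL) is a positive integer, the function u_ε(φ,θ) = ε²·F(φ/ε, θ/ε)·v''(φ) satisfies ε⁻¹·∫_{R^ε} ( |u_ε(φ,θ)|² + ‖∇u_ε(φ,θ)‖² )·cos θ dφ dθ ≤ K·ε². -/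
open MeasureTheory Filter Real Set
open scoped ENNReal Topology

lemma aux_bound (L : ℝ) (hLp : 0 < L) (g₁ : ℝ) (F : ℝ × ℝ → ℝ) (hF : ContDiff ℝ 1 F)
    (hFper : ∀ y z : ℝ, F (y + L, z) = F (y, z)) :
    ∃ B : ℝ, 0 ≤ B ∧ ∀ y z : ℝ, 0 ≤ z → z ≤ g₁ → |F (y, z)| ≤ B ∧ ‖fderiv ℝ F (y, z)‖ ≤ B := by
  have hK : IsCompact (Icc (0 : ℝ) L ×ˢ Icc (0 : ℝ) g₁) := isCompact_Icc.prod isCompact_Icc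
  obtain ⟨B₁, hB₁⟩ := hK.exists_bound_of_continuousOn hF.continuous.continuousOn
  obtain ⟨B₂, hB₂⟩ := hK.exists_bound_of_continuousOn
    (hF.continuous_fderiv one_ne_zero).continuousOn
  refine ⟨max (max B₁ B₂) 0, le_max_right _ _, fun y z hz0 hz1 => ?_⟩
  have hper : Function.Periodic (fun y => (F (y, z), fderiv ℝ F (y, z))) L := by
    intro y
    have hfun : (fun q : ℝ × ℝ => F (q + (L, 0))) = F := by
      funext q
      obtain ⟨q1, q2⟩ := q
      simpa using hFper q1 q2
    have h2 : fderiv ℝ F (y + L, z) = fderiv ℝ F (y, z) := by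
      have := fderiv_comp_add_right (𝕜 := ℝ) (f := F) (x := (y, z)) (L, 0)
      rw [hfun] at this
      simpa using this.symm
    simp [hFper, h2]
  obtain ⟨y', hy', he⟩ := hper.exists_mem_Ico₀ hLp y
  simp only [Prod.mk.injEq] at he
  rw [he.1, he.2]
  have hm : (y', z) ∈ Icc (0 : ℝ) L ×ˢ Icc (0 : ℝ) g₁ := ⟨⟨hy'.1, hy'.2.le⟩, hz0, hz1⟩
  exact ⟨(hB₁ _ hm).trans ((le_max_left _ _).trans (le_max_left _ _)),
    (hB₂ _ hm).trans ((le_max_right _ _).trans (le_max_left _ _))⟩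

lemma aux_fderiv (F : ℝ × ℝ → ℝ) (hF : ContDiff ℝ 1 F) (w : ℝ → ℝ) (w' ε : ℝ)
    (p : ℝ × ℝ) (hw : HasDerivAt w w' p.1) (d : ℝ × ℝ) :
    fderiv ℝ (fun q : ℝ × ℝ => ε ^ 2 * F (q.1 / ε, q.2 / ε) * w q.1) p d =
      ε ^ 2 * (ε⁻¹ * fderiv ℝ F (p.1 / ε, p.2 / ε) d) * w p.1
        + ε ^ 2 * F (p.1 / ε, p.2 / ε) * (w' * d.1) := by
  have e : ∀ q : ℝ × ℝ, ((q.1 / ε, q.2 / ε) : ℝ × ℝ) = ε⁻¹ • q := by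
    intro q
    ext <;> simp [div_eq_inv_mul]
  simp only [e]
  have h1 : HasFDerivAt (fun q : ℝ × ℝ => ε⁻¹ • q)
      (ε⁻¹ • ContinuousLinearMap.id ℝ (ℝ × ℝ)) p := (hasFDerivAt_id p).const_smul ε⁻¹
  have h2 : HasFDerivAt F (fderiv ℝ F (ε⁻¹ • p)) (ε⁻¹ • p) :=
    (hF.differentiable one_ne_zero _).hasFDerivAt
  have h3 := (h2.comp p h1).const_mul (ε ^ 2)
  have h4 := hw.hasFDerivAt.comp p hasFDerivAt_fst
  have h5 := h3.mul h4
  have h6 : fderiv ℝ (fun q : ℝ × ℝ => ε ^ 2 * F (ε⁻¹ • q) * w q.1) p = _ := h5.fderiv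
  rw [h6]
  simp
  ring

/-- Second-order corrector estimate: for `F` continuously differentiable and `L`-periodic in
its first variable, and `v` three times continuously differentiable with `v''` and `v'''`
bounded on `(0,2π)`, the function `u_ε(φ,θ) = ε²·F(φ/ε,θ/ε)·v''(φ)` satisfies
`ε⁻¹ ∫_{R^ε} (|u_ε|² + ‖∇u_ε‖²) cos θ ≤ K ε²` for a constant `K` independent of `ε`. -/
theorem second_order_corrector_estimate
    (a : ℕ) (ha : 0 < a) (L : ℝ) (hL : L = 2 * π / a)
    (g : ℝ → ℝ) (hgc : Continuous g) (hper : ∀ y, g (y + L) = g y)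
    (g₁ : ℝ) (hg₁pos : 0 < g₁) (hg₁lt : g₁ < π / 2)
    (hgpos : ∀ y, 0 < g y) (hgle : ∀ y, g y ≤ g₁)
    (F : ℝ × ℝ → ℝ) (hF : ContDiff ℝ 1 F)
    (hFper : ∀ y z : ℝ, F (y + L, z) = F (y, z))
    (v : ℝ → ℝ) (hv : ContDiff ℝ 3 v)
    (M : ℝ) (hv2 : ∀ x ∈ Ioo (0 : ℝ) (2 * π), |iteratedDeriv 2 v x| ≤ M)
    (hv3 : ∀ x ∈ Ioo (0 : ℝ) (2 * π), |iteratedDeriv 3 v x| ≤ M) :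
    ∃ K > (0 : ℝ), ∀ ε ∈ Ioc (0 : ℝ) 1, ∀ N : ℕ, 0 < N → (N : ℝ) = 2 * π / (ε * L) →
      ε⁻¹ *
        ∫ p in {p : ℝ × ℝ | 0 < p.1 ∧ p.1 < 2 * π ∧ 0 < p.2 ∧ p.2 < ε * g (p.1 / ε)},
          ((ε ^ 2 * F (p.1 / ε, p.2 / ε) * iteratedDeriv 2 v p.1) ^ 2 +
            ((fderiv ℝ
              (fun q : ℝ × ℝ => ε ^ 2 * F (q.1 / ε, q.2 / ε) * iteratedDeriv 2 v q.1)
              p (1, 0)) ^ 2 +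
             (fderiv ℝ
              (fun q : ℝ × ℝ => ε ^ 2 * F (q.1 / ε, q.2 / ε) * iteratedDeriv 2 v q.1)
              p (0, 1)) ^ 2)) * Real.cos p.2
        ≤ K * ε ^ 2 := by
  have hLp : 0 < L := by rw [hL]; positivity
  obtain ⟨B, hB0, hB⟩ := aux_bound L hLp g₁ F hF hFper
  have hM0 : 0 ≤ M := (abs_nonneg _).trans (hv2 π ⟨pi_pos, by linarith [pi_pos]⟩)
  refine ⟨6 * (B * M) ^ 2 * (2 * π * g₁) + 1, by positivity, ?_⟩
  rintro ε ⟨hε0, hε1⟩ N - -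
  set S : Set (ℝ × ℝ) := {p : ℝ × ℝ | 0 < p.1 ∧ p.1 < 2 * π ∧ 0 < p.2 ∧ p.2 < ε * g (p.1 / ε)}
    with hS
  have hsub : S ⊆ Ioo 0 (2 * π) ×ˢ Ioo 0 (ε * g₁) := by
    rintro p ⟨h1, h2, h3, h4⟩
    exact ⟨⟨h1, h2⟩, h3, h4.trans_le (mul_le_mul_of_nonneg_left (hgle _) hε0.le)⟩
  have hvol : (volume : Measure (ℝ × ℝ)) (Ioo 0 (2 * π) ×ˢ Ioo 0 (ε * g₁))
      = ENNReal.ofReal (2 * π * (ε * g₁)) := by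
    rw [Measure.volume_eq_prod, Measure.prod_prod, Real.volume_Ioo, Real.volume_Ioo, sub_zero,
      sub_zero, ← ENNReal.ofReal_mul (by positivity)]
  have hle := measure_mono (μ := (volume : Measure (ℝ × ℝ))) hsub
  rw [hvol] at hle
  have hreal : (volume : Measure (ℝ × ℝ)).real S ≤ 2 * π * (ε * g₁) :=
    ENNReal.toReal_le_of_le_ofReal (by positivity) hle
  have hw : ∀ x, HasDerivAt (iteratedDeriv 2 v) (iteratedDeriv 3 v x) x := by
    intro x
    rw [iteratedDeriv_succ (n := 2)]
    exact (hv.differentiable_iteratedDeriv 2 (by norm_num) x).hasDerivAt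
  have key := norm_setIntegral_le_of_norm_le_const (μ := (volume : Measure (ℝ × ℝ))) (s := S)
    (C := 6 * (B * M) ^ 2 * ε ^ 2)
    (f := fun p : ℝ × ℝ => ((ε ^ 2 * F (p.1 / ε, p.2 / ε) * iteratedDeriv 2 v p.1) ^ 2 +
            ((fderiv ℝ
              (fun q : ℝ × ℝ => ε ^ 2 * F (q.1 / ε, q.2 / ε) * iteratedDeriv 2 v q.1)
              p (1, 0)) ^ 2 +
             (fderiv ℝ
              (fun q : ℝ × ℝ => ε ^ 2 * F (q.1 / ε, q.2 / ε) * iteratedDeriv 2 v q.1)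
              p (0, 1)) ^ 2)) * Real.cos p.2) (hle.trans_lt ENNReal.ofReal_lt_top) ?_
  · have h1 := (le_abs_self _).trans key
    have h2 : 6 * (B * M) ^ 2 * ε ^ 2 * (volume : Measure (ℝ × ℝ)).real S
        ≤ 6 * (B * M) ^ 2 * ε ^ 2 * (2 * π * (ε * g₁)) :=
      mul_le_mul_of_nonneg_left hreal (by positivity)
    refine (mul_le_mul_of_nonneg_left (h1.trans h2) (inv_nonneg.2 hε0.le)).trans ?_
    have h3 : ε⁻¹ * (6 * (B * M) ^ 2 * ε ^ 2 * (2 * π * (ε * g₁)))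
        = 6 * (B * M) ^ 2 * (2 * π * g₁) * ε ^ 2 := by
      field_simp
    rw [h3]
    nlinarith [sq_nonneg ε]
  · intro p hp
    obtain ⟨h1, h2⟩ := hsub hp
    have hz0 : 0 ≤ p.2 / ε := div_nonneg h2.1.le hε0.le
    have hz1 : p.2 / ε ≤ g₁ := by
      rw [div_le_iff₀ hε0]; linarith [h2.2]
    obtain ⟨b1, b2⟩ := hB (p.1 / ε) (p.2 / ε) hz0 hz1
    have c2 := hv2 _ h1
    have c3 := hv3 _ h1
    simp only [aux_fderiv F hF _ _ ε p (hw p.1)]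
    have d1 : |fderiv ℝ F (p.1 / ε, p.2 / ε) (1, 0)| ≤ B := by
      refine ((fderiv ℝ F (p.1 / ε, p.2 / ε)).le_opNorm _).trans ?_
      simpa [Prod.norm_def] using b2
    have d2 : |fderiv ℝ F (p.1 / ε, p.2 / ε) (0, 1)| ≤ B := by
      refine ((fderiv ℝ F (p.1 / ε, p.2 / ε)).le_opNorm _).trans ?_
      simpa [Prod.norm_def] using b2
    generalize fderiv ℝ F (p.1 / ε, p.2 / ε) (1, 0) = D1 at *
    generalize fderiv ℝ F (p.1 / ε, p.2 / ε) (0, 1) = D2 at *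
    generalize F (p.1 / ε, p.2 / ε) = f at *
    generalize iteratedDeriv 2 v p.1 = w2 at *
    generalize iteratedDeriv 3 v p.1 = w3 at *
    have P : ∀ {x y : ℝ}, |x| ≤ B → |y| ≤ M → |x * y| ≤ B * M := fun hx hy => by
      rw [abs_mul]; exact mul_le_mul hx hy (abs_nonneg _) hB0
    have hBM : 0 ≤ B * M := mul_nonneg hB0 hM0
    have hεε : ε ^ 2 ≤ ε := by nlinarith
    have E : ∀ {x : ℝ}, |x| ≤ B * M → |ε ^ 2 * x| ≤ ε * (B * M) := fun hx => by
      rw [abs_mul, abs_of_nonneg (sq_nonneg ε)]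
      exact mul_le_mul hεε hx (abs_nonneg _) hε0.le
    have E' : ∀ {x : ℝ}, |x| ≤ B * M → |ε * x| ≤ ε * (B * M) := fun hx => by
      rw [abs_mul, abs_of_nonneg hε0.le]
      exact mul_le_mul_of_nonneg_left hx hε0.le
    have q0 : (ε ^ 2 * f * w2) ^ 2 ≤ (ε * (B * M)) ^ 2 := by
      rw [mul_assoc]; exact sq_le_sq' (abs_le.1 (E (P b1 c2))).1 (abs_le.1 (E (P b1 c2))).2
    have r1 : ε ^ 2 * (ε⁻¹ * D1) * w2 + ε ^ 2 * f * (w3 * 1)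
        = ε * (D1 * w2) + ε ^ 2 * (f * w3) := by
      field_simp
    have r2 : ε ^ 2 * (ε⁻¹ * D2) * w2 + ε ^ 2 * f * (w3 * 0) = ε * (D2 * w2) := by
      field_simp
      ring
    have q1 : (ε * (D1 * w2) + ε ^ 2 * (f * w3)) ^ 2 ≤ (2 * (ε * (B * M))) ^ 2 := by
      have s1 := abs_le.1 (E' (P d1 c2))
      have s2 := abs_le.1 (E (P b1 c3))
      apply sq_le_sq' <;> linarith [s1.1, s1.2, s2.1, s2.2]
    have q2 : (ε * (D2 * w2)) ^ 2 ≤ (ε * (B * M)) ^ 2 :=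
      sq_le_sq' (abs_le.1 (E' (P d2 c2))).1 (abs_le.1 (E' (P d2 c2))).2
    rw [r1, r2, norm_mul]
    refine (mul_le_of_le_one_right (norm_nonneg _) (Real.abs_cos_le_one _)).trans ?_
    rw [Real.norm_of_nonneg (by positivity)]
    nlinarith
end
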